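/- arXiv:2212.14420 — 2 statements merged into one kernel-verified Lean document; each statement's English description precedes it below -/
import Mathlib

section
/- The differential of the pong algebra squares to zero: ∂ ∘ ∂ = 0 as a map P(m, k) → P(m, k). -/
open scoped Classical BigOperators

noncomputable section

/-- The group `G_m` of bijections of `ℤ` generated by the reflections
`x ↦ 1 - x` (about `1/2`) and `x ↦ 2m - 1 - x` (about `m - 1/2`). -/
def Gm (m : ℕ) : Subgroup (Equiv.Perm ℤ) :=
  Subgroup.closure {Equiv.subLeft (1 : ℤ), Equiv.subLeft (2 * (m : ℤ) - 1)}

/-- `y` lies in the `G_m`-orbit of `x`. -/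
def GmRel (m : ℕ) (x y : ℤ) : Prop := ∃ g ∈ Gm m, g x = y

/-- The `G_m`-orbit of an integer. -/
def GmOrbit (m : ℕ) (x : ℤ) : Set ℤ := {y | GmRel m x y}

/-- `(S, f)` is a lifted partial permutation on `k` letters: `S` is a
`G_m`-invariant subset of `ℤ`, `f` is `G_m`-equivariant on `S`, the quotient
`S/G_m` has exactly `k` elements, and the induced map `S/G_m → ℤ/G_m` is
injective.  (The values of `f` off `S` are irrelevant.) -/
structure IsLPP (m k : ℕ) (S : Set ℤ) (f : ℤ → ℤ) : Prop where
  invariant : ∀ g ∈ Gm m, ∀ x ∈ S, g x ∈ S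
  equivariant : ∀ g ∈ Gm m, ∀ x ∈ S, f (g x) = g (f x)
  orbits : (GmOrbit m '' S).ncard = k
  inj : ∀ x ∈ S, ∀ y ∈ S, GmRel m (f x) (f y) → GmRel m x y

/-- `(i, j)` is a crossing pair for `(S, f)`. -/
def IsCrossing (S : Set ℤ) (f : ℤ → ℤ) (i j : ℤ) : Prop :=
  i ∈ S ∧ j ∈ S ∧ i < j ∧ f j < f i

/-- The `G_m`-orbit of the unordered pair `{p.1, p.2}`; two pairs are
equivalent exactly when they have the same `pairOrbit`. -/
def pairOrbit (m : ℕ) (p : ℤ × ℤ) : Set (Set ℤ) :=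
  {A | ∃ g ∈ Gm m, A = {g p.1, g p.2}}

/-- The set of crossings of `(S, f)` (equivalence classes of crossing pairs). -/
def crossings (m : ℕ) (S : Set ℤ) (f : ℤ → ℤ) : Set (Set (Set ℤ)) :=
  pairOrbit m '' {p : ℤ × ℤ | IsCrossing S f p.1 p.2}

/-- The number of crossings `cross(f)`. -/
def crossCount (m : ℕ) (S : Set ℤ) (f : ℤ → ℤ) : ℕ := (crossings m S f).ncard

/-- The set whose cardinality (halved) is the weight `w_j(S, f)`. -/
def weightSet (j : ℤ) (S : Set ℤ) (f : ℤ → ℤ) : Set ℤ :=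
  {i | i ∈ S ∧ (((i : ℚ) < (j : ℚ) - 1/2 ∧ (j : ℚ) - 1/2 < (f i : ℚ)) ∨
    ((f i : ℚ) < (j : ℚ) - 1/2 ∧ (j : ℚ) - 1/2 < (i : ℚ)))}

/-- The weight `w_j(S, f)`. -/
def weight (j : ℤ) (S : Set ℤ) (f : ℤ → ℤ) : ℚ := (weightSet j S f).ncard / 2

/-- The resolution `f_{⟨i,j⟩}` of `f` at the crossing `⟨i, j⟩`. -/
def resolveFun (m : ℕ) (f : ℤ → ℤ) (i j : ℤ) : ℤ → ℤ := fun x =>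
  if h : ∃ g ∈ Gm m, g i = x then h.choose (f j)
  else if h' : ∃ g ∈ Gm m, g j = x then h'.choose (f i)
  else f x

/-- The graph `Γ_f = {(i, f i) : i ∈ S}`. -/
def graphOf (S : Set ℤ) (f : ℤ → ℤ) : Set (ℤ × ℤ) :=
  {p | p.1 ∈ S ∧ p.2 = f p.1}

/-- The `G_m`-orbit of a point of `ℤ × ℤ` under the diagonal action. -/
def GmOrbit2 (m : ℕ) (p : ℤ × ℤ) : Set (ℤ × ℤ) :=
  {q | ∃ g ∈ Gm m, (g p.1, g p.2) = q}

/-- The left endpoint of the image of the unit interval `[a, a+1]` under the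
affine extension of `g` to `ℝ`. -/
def sqIdx (g : Equiv.Perm ℤ) (a : ℤ) : ℤ := min (g a) (g (a + 1))

/-- The `G_m`-orbit of it the unit square indexed by `p`. -/
def sqOrbit (m : ℕ) (p : ℤ × ℤ) : Set (ℤ × ℤ) :=
  {q | ∃ g ∈ Gm m, (sqIdx g p.1, sqIdx g p.2) = q}

/-- `D` is a domain from `(S, f)` to `(T, g)`: a `G_m`-invariant assignment of
multiplicities to unit squares, nonzero on finitely many `G_m`-orbits of
squares, whose corners are governed by the two graphs. -/
def IsHDomain (m : ℕ) (S : Set ℤ) (f : ℤ → ℤ) (T : Set ℤ) (g : ℤ → ℤ)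
    (D : ℤ × ℤ → ℤ) : Prop :=
  (∀ γ ∈ Gm m, ∀ a b : ℤ, D (sqIdx γ a, sqIdx γ b) = D (a, b)) ∧
  (sqOrbit m '' {p : ℤ × ℤ | D p ≠ 0}).Finite ∧
  (∀ i j : ℤ,
    D (i, j) + D (i - 1, j - 1) - D (i, j - 1) - D (i - 1, j) =
      (if (i, j) ∈ graphOf T g then 1 else 0) -
        (if (i, j) ∈ graphOf S f then 1 else 0))

/-- The basis of the pong algebra: lifted partial permutations, normalized to
be the identity off their domain (so that each lifted partial permutation is
represented by exactly one basis element). -/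
def PongIdx (m k : ℕ) : Type :=
  {P : Set ℤ × (ℤ → ℤ) // IsLPP m k P.1 P.2 ∧ ∀ x ∉ P.1, P.2 x = x}

/-- The ground ring `F₂[v₁, …, v_m]` of the pong algebra. -/
abbrev PongRing (m : ℕ) := MvPolynomial (Fin m) (ZMod 2)

/-- The exponent vector `(w_l(f) - w_l(f'))_{l=1}^m` appearing in the
differential of the pong algebra. -/
def expDiff (m : ℕ) (S : Set ℤ) (f f' : ℤ → ℤ) : Fin m →₀ ℕ :=
  Finsupp.equivFunOnFinite.symm fun l =>
    ((weightSet (((l : ℕ) : ℤ) + 1) S f).ncard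
      - (weightSet (((l : ℕ) : ℤ) + 1) S f').ncard) / 2

/-- The exponent vector `(w_l(f) + w_l(g) - w_l(g ∘ f))_{l=1}^m` appearing in
the product of the pong algebra. -/
def expMul (m : ℕ) (S T : Set ℤ) (f g : ℤ → ℤ) : Fin m →₀ ℕ :=
  Finsupp.equivFunOnFinite.symm fun l =>
    ((weightSet (((l : ℕ) : ℤ) + 1) S f).ncard
      + (weightSet (((l : ℕ) : ℤ) + 1) T g).ncard
      - (weightSet (((l : ℕ) : ℤ) + 1) S (g ∘ f)).ncard) / 2

/-- The set of crossings of `(S, f)` whose resolution drops the crossing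
number by exactly one and yields the function `f'` (on `S`). -/
def resCrossSet (m : ℕ) (S : Set ℤ) (f f' : ℤ → ℤ) : Set (Set (Set ℤ)) :=
  pairOrbit m '' {p : ℤ × ℤ | IsCrossing S f p.1 p.2 ∧
    Set.EqOn (resolveFun m f p.1 p.2) f' S ∧
    crossCount m S (resolveFun m f p.1 p.2) + 1 = crossCount m S f}

/-- The structure constants of the differential `∂` of the pong algebra:
`∂ (S, f) = Σ_q Mdiff((S,f), q) · q`. -/
def Mdiff (m k : ℕ) (p q : PongIdx m k) : PongRing m :=
  if q.1.1 = p.1.1 then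
    MvPolynomial.monomial (expDiff m p.1.1 p.1.2 q.1.2)
      ((resCrossSet m p.1.1 p.1.2 q.1.2).ncard : ZMod 2)
  else 0

/-- The structure constants of the product `μ₂` of the pong algebra:
`μ₂(p, q) = Σ_s Mmul(p, q, s) · s`. -/
def Mmul (m k : ℕ) (p q s : PongIdx m k) : PongRing m :=
  if q.1.1 = p.1.2 '' p.1.1 ∧
      crossCount m p.1.1 (q.1.2 ∘ p.1.2)
        = crossCount m p.1.1 p.1.2 + crossCount m q.1.1 q.1.2 ∧
      s.1.1 = p.1.1 ∧ Set.EqOn s.1.2 (q.1.2 ∘ p.1.2) p.1.1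
  then MvPolynomial.monomial (expMul m p.1.1 q.1.1 p.1.2 q.1.2) 1
  else 0



/-- Combinatorial data of inversion sets `N x` of reflections `t : T` acting on the right of a set
`X`, in which every nonempty inversion set contains a simple reflection. -/
structure InversionSystem (X T : Type*) where
  act : X → T → X
  conj : T → T → T
  N : X → Finset T
  simple : T → Prop
  act_act : ∀ x t, act (act x t) t = x
  act_conj : ∀ x s t, act (act x s) (conj s t) = act (act x t) s
  conj_conj : ∀ s t, conj s (conj s t) = t
  conj_self : ∀ s, conj s s = s
  conj_mem : ∀ x s t, simple s → t ∈ N x → t ≠ s → conj s t ∈ N (act x s)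
  self_mem : ∀ x s, s ∈ N (act x s) ↔ s ∉ N x
  exists_simple : ∀ x, (N x).Nonempty → ∃ s ∈ N x, simple s

namespace InversionSystem

variable {X T : Type*} (I : InversionSystem X T)

/-- The number of inversions. -/
def len (x : X) : ℕ := (I.N x).card

/-- The inversions whose resolution drops the length by exactly one. -/
def covers (x : X) : Finset T := {t ∈ I.N x | I.len (I.act x t) + 1 = I.len x}

theorem conj_ne {s t : T} (h : t ≠ s) : I.conj s t ≠ s := fun h' =>
  h (by rw [← I.conj_conj s t, h', I.conj_self])

theorem N_act {x : X} {s : T} (hs : I.simple s) (h : s ∉ I.N x) :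
    I.N (I.act x s) = insert s ((I.N x).image (I.conj s)) := by
  ext t
  simp only [Finset.mem_insert, Finset.mem_image]
  constructor
  · intro ht
    by_cases hts : t = s
    · exact Or.inl hts
    · refine Or.inr ⟨I.conj s t, ?_, I.conj_conj s t⟩
      simpa only [I.act_act] using I.conj_mem _ s t hs ht hts
  · rintro (rfl | ⟨u, hu, rfl⟩)
    · exact (I.self_mem x t).2 h
    · exact I.conj_mem x s u hs hu (fun h' => h (h' ▸ hu))

theorem conj_injective (s : T) : Function.Injective (I.conj s) := fun a b h => by
  rw [← I.conj_conj s a, h, I.conj_conj]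

theorem notMem_image_conj {x : X} {s : T} (h : s ∉ I.N x) : s ∉ (I.N x).image (I.conj s) := by
  simp only [Finset.mem_image, not_exists, not_and]
  exact fun t ht => I.conj_ne (fun h' => h (h' ▸ ht))

theorem len_act {x : X} {s : T} (hs : I.simple s) (h : s ∉ I.N x) :
    I.len (I.act x s) = I.len x + 1 := by
  rw [len, I.N_act hs h, Finset.card_insert_of_notMem (I.notMem_image_conj h),
    Finset.card_image_of_injective _ (I.conj_injective s), len]

theorem notMem_act {x : X} {s : T} (h : s ∈ I.N x) : s ∉ I.N (I.act x s) := fun h' =>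
  (I.self_mem x s).1 h' h

theorem len_act' {x : X} {s : T} (hs : I.simple s) (h : s ∈ I.N x) :
    I.len (I.act x s) + 1 = I.len x := by
  rw [← I.len_act hs (I.notMem_act h), I.act_act]

theorem len_act_lt {x : X} {t : T} (ht : t ∈ I.N x) : I.len (I.act x t) < I.len x := by
  induction hn : I.len x generalizing x t with
  | zero => exact absurd ht (by simp [Finset.card_eq_zero.1 hn])
  | succ n ih =>
    obtain ⟨s, hsN, hs⟩ := I.exists_simple x ⟨t, ht⟩
    have hlen := I.len_act' hs hsN
    by_cases hts : t = s
    · subst hts; omega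
    · have h := ih (I.conj_mem x s t hs ht hts) (by omega)
      rw [I.act_conj] at h
      by_cases hs' : s ∈ I.N (I.act x t)
      · have := I.len_act' hs hs'; omega
      · have := I.len_act hs hs'; omega

/-- The differential of a basis element. -/
def d (x : X) : X →₀ ZMod 2 := ∑ t ∈ I.covers x, Finsupp.single (I.act x t) 1

/-- The linear extension of the differential. -/
def D : (X →₀ ZMod 2) →ₗ[ZMod 2] X →₀ ZMod 2 := Finsupp.linearCombination (ZMod 2) I.d

/-- Nil-Coxeter multiplication by a reflection. -/
def mulRight (s : T) : (X →₀ ZMod 2) →ₗ[ZMod 2] X →₀ ZMod 2 :=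
  Finsupp.linearCombination (ZMod 2) fun x =>
    if s ∈ I.N x then 0 else Finsupp.single (I.act x s) 1

theorem D_single (x : X) : I.D (Finsupp.single x 1) = I.d x := by simp [D]

theorem mulRight_single (s : T) (x : X) : I.mulRight s (Finsupp.single x 1) =
    if s ∈ I.N x then 0 else Finsupp.single (I.act x s) 1 := by simp [mulRight]

theorem mulRight_mulRight (s : T) (v : X →₀ ZMod 2) : I.mulRight s (I.mulRight s v) = 0 := by
  have : I.mulRight s ∘ₗ I.mulRight s = 0 := by
    refine Finsupp.lhom_ext' fun x => LinearMap.ext_ring ?_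
    simp only [LinearMap.comp_apply, Finsupp.lsingle_apply, mulRight_single, LinearMap.zero_apply]
    split_ifs with h
    · simp
    · rw [mulRight_single, if_pos ((I.self_mem x s).2 h)]
  exact LinearMap.congr_fun this v

theorem covers_act {x : X} {s : T} (hs : I.simple s) (h : s ∉ I.N x) :
    I.covers (I.act x s) =
      insert s (({t ∈ I.covers x | s ∉ I.N (I.act x t)} : Finset T).image (I.conj s)) := by
  have hlen := I.len_act hs h
  ext u
  simp only [covers, Finset.mem_filter, I.N_act hs h, Finset.mem_insert, Finset.mem_image]
  by_cases hus : u = s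
  · subst hus
    simp [I.act_act, hlen]
  · simp only [hus, false_or]
    have key : ∀ t ∈ I.N x, (I.len (I.act (I.act x s) (I.conj s t)) + 1 = I.len (I.act x s) ↔
        I.len (I.act x t) + 1 = I.len x ∧ s ∉ I.N (I.act x t)) := by
      intro t ht
      rw [I.act_conj]
      have hlt := I.len_act_lt ht
      by_cases hs' : s ∈ I.N (I.act x t)
      · have := I.len_act' hs hs'
        simp only [hs', not_true_eq_false, and_false, iff_false]; omega
      · have := I.len_act hs hs'
        simp only [hs', not_false_eq_true, and_true]; omega
    constructor
    · rintro ⟨⟨t, ht, rfl⟩, hl⟩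
      have := (key t ht).1 hl
      exact ⟨t, ⟨⟨ht, this.1⟩, this.2⟩, rfl⟩
    · rintro ⟨t, ⟨⟨ht, h1⟩, h2⟩, rfl⟩
      exact ⟨⟨t, ht, rfl⟩, (key t ht).2 ⟨h1, h2⟩⟩

theorem d_act {x : X} {s : T} (hs : I.simple s) (h : s ∉ I.N x) :
    I.d (I.act x s) = Finsupp.single x 1 + I.mulRight s (I.d x) := by
  have hn : s ∉ (({t ∈ I.covers x | s ∉ I.N (I.act x t)} : Finset T).image (I.conj s)) := by
    refine fun hm => I.notMem_image_conj h (Finset.image_subset_image ?_ hm)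
    exact (Finset.filter_subset _ _).trans (Finset.filter_subset _ _)
  rw [d, I.covers_act hs h, Finset.sum_insert hn, I.act_act,
    Finset.sum_image (I.conj_injective s).injOn, d, map_sum, Finset.sum_filter]
  congr 1
  refine Finset.sum_congr rfl fun t _ => ?_
  rw [mulRight_single, I.act_conj]
  split_ifs <;> simp_all

theorem add_self_eq_zero (v : X →₀ ZMod 2) : v + v = 0 := by
  ext x; exact CharTwo.add_self_eq_zero _

theorem D_mulRight {s : T} (hs : I.simple s) (v : X →₀ ZMod 2) :
    I.D (I.mulRight s v) = v + I.mulRight s (I.D v) := by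
  have : I.D ∘ₗ I.mulRight s = LinearMap.id + I.mulRight s ∘ₗ I.D := by
    refine Finsupp.lhom_ext' fun x => LinearMap.ext_ring ?_
    simp only [LinearMap.comp_apply, Finsupp.lsingle_apply, mulRight_single, LinearMap.add_apply,
      LinearMap.id_apply, D_single]
    split_ifs with h
    · have h' := I.notMem_act h
      have := I.d_act hs h'
      rw [I.act_act] at this
      rw [this, map_add, mulRight_mulRight, mulRight_single, if_neg h', I.act_act, add_zero,
        add_self_eq_zero, map_zero]
    · rw [D_single, I.d_act hs h]
  exact LinearMap.congr_fun this v

theorem D_d (x : X) : I.D (I.d x) = 0 := by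
  induction hn : I.len x generalizing x with
  | zero => simp [d, covers, Finset.card_eq_zero.1 hn]
  | succ n ih =>
    obtain ⟨s, hsN, hs⟩ := I.exists_simple x (Finset.card_pos.1 (show 0 < I.len x by omega))
    have hlen := I.len_act' hs hsN
    have h := I.d_act hs (I.notMem_act hsN)
    rw [I.act_act] at h
    rw [h, map_add, I.D_mulRight hs, ih _ (by omega), map_zero, add_zero, D_single,
      add_self_eq_zero]

theorem d_apply (x y : X) :
    I.d x y = (({t ∈ I.covers x | I.act x t = y} : Finset T).card : ZMod 2) := by
  simp [d, Finsupp.finsetSum_apply, Finsupp.single_apply, Finset.sum_boole]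

theorem finsum_d_mul_d (x z : X) : ∑ᶠ y, I.d x y * I.d y z = 0 := by
  rw [finsum_eq_sum_of_support_subset (s := (I.d x).support)]
  · have := DFunLike.congr_fun (I.D_d x) z
    simpa [D, Finsupp.linearCombination_apply, Finsupp.sum, Finsupp.finsetSum_apply] using this
  · intro y hy
    simp only [Function.mem_support] at hy
    simpa using left_ne_zero_of_mul hy

end InversionSystem

section Group

variable {m : ℕ}

theorem Gm_apply_eq {g : Equiv.Perm ℤ} (hg : g ∈ Gm m) : ∃ n : ℤ,
    (∀ x, g x = x + (2 * m - 2) * n) ∨ (∀ x, g x = 1 - x + (2 * m - 2) * n) := by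
  induction hg using Subgroup.closure_induction with
  | mem g hg =>
    rcases hg with rfl | rfl
    · exact ⟨0, Or.inr fun x => by simp⟩
    · exact ⟨1, Or.inr fun x => by simp; ring⟩
  | one => exact ⟨0, Or.inl fun x => by simp⟩
  | mul a b _ _ ha hb =>
    obtain ⟨n, hn | hn⟩ := ha <;> obtain ⟨l, hl | hl⟩ := hb
    · exact ⟨n + l, Or.inl fun x => by simp only [Equiv.Perm.mul_apply, hn, hl]; ring⟩
    · exact ⟨n + l, Or.inr fun x => by simp only [Equiv.Perm.mul_apply, hn, hl]; ring⟩
    · exact ⟨n - l, Or.inr fun x => by simp only [Equiv.Perm.mul_apply, hn, hl]; ring⟩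
    · exact ⟨n - l, Or.inl fun x => by simp only [Equiv.Perm.mul_apply, hn, hl]; ring⟩
  | inv a _ ha =>
    obtain ⟨n, hn | hn⟩ := ha
    · exact ⟨-n, Or.inl fun x => by rw [Equiv.Perm.inv_eq_iff_eq, hn]; ring⟩
    · exact ⟨n, Or.inr fun x => by rw [Equiv.Perm.inv_eq_iff_eq, hn]; ring⟩

theorem Gm_add_or_sub {g : Equiv.Perm ℤ} (hg : g ∈ Gm m) : ∃ a : ℤ,
    (∀ x, g x = x + a) ∨ (∀ x, g x = a - x) := by
  obtain ⟨n, h | h⟩ := Gm_apply_eq hg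
  · exact ⟨_, Or.inl h⟩
  · exact ⟨1 + (2 * m - 2) * n, Or.inr fun x => by rw [h]; ring⟩

/-- `G_m` acts freely on `ℤ`. -/
theorem Gm_eq_one {g : Equiv.Perm ℤ} (hg : g ∈ Gm m) {x : ℤ} (hx : g x = x) : g = 1 := by
  obtain ⟨n, h | h⟩ := Gm_apply_eq hg
  · ext y
    have := h x
    have := h y
    simp only [Equiv.Perm.one_apply]
    omega
  · have h1 := h x
    have : (2 * (m : ℤ) - 2) * n = 2 * ((m - 1) * n) := by ring
    omega

theorem Gm_ext {g h : Equiv.Perm ℤ} (hg : g ∈ Gm m) (hh : h ∈ Gm m) {x : ℤ} (hx : g x = h x) :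
    g = h := by
  have : h⁻¹ * g = 1 := Gm_eq_one (mul_mem (inv_mem hh) hg) (x := x) (by simp [hx])
  exact (inv_mul_eq_one.1 this).symm

theorem Gm_translation (n : ℤ) : ∃ g ∈ Gm m, ∀ x, g x = x + (2 * m - 2) * n := by
  have h1 : ∃ g ∈ Gm m, ∀ x, g x = x + (2 * m - 2) :=
    ⟨Equiv.subLeft (2 * (m : ℤ) - 1) * Equiv.subLeft 1,
      mul_mem (Subgroup.subset_closure (by simp)) (Subgroup.subset_closure (by simp)),
      fun x => by simp; ring⟩
  obtain ⟨g, hg, h⟩ := h1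
  induction n with
  | zero => exact ⟨1, one_mem _, by simp⟩
  | succ n ih =>
    obtain ⟨g', hg', h'⟩ := ih
    exact ⟨g * g', mul_mem hg hg', fun x => by rw [Equiv.Perm.mul_apply, h, h']; ring⟩
  | pred n ih =>
    obtain ⟨g', hg', h'⟩ := ih
    exact ⟨g⁻¹ * g', mul_mem (inv_mem hg) hg', fun x => by
      rw [Equiv.Perm.mul_apply, Equiv.Perm.inv_eq_iff_eq, h, h']; ring⟩

/-- Every integer is translated by `G_m` to a representative modulo `2m - 2`. -/
theorem exists_Gm_emod (hm : 2 ≤ m) (x : ℤ) :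
    ∃ g ∈ Gm m, (∀ y, g y = y - (2 * m - 2) * (x / (2 * m - 2))) ∧
      g x ∈ Set.Ico (0 : ℤ) (2 * m - 2) := by
  obtain ⟨g, hg, h⟩ := Gm_translation (m := m) (-(x / (2 * m - 2)))
  have h1 := Int.emod_nonneg x (b := 2 * m - 2) (by omega)
  have h2 := Int.emod_lt_of_pos x (b := 2 * m - 2) (by omega)
  have h3 := Int.emod_add_mul_ediv x (2 * m - 2)
  refine ⟨g, hg, fun y => by rw [h]; ring, ?_⟩
  have := h x
  rw [Set.mem_Ico]
  constructor <;> linarith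

end Group

/-- `t` is a reflection of `S`: a `G_m`-equivariant involution which exchanges the orbits of two
elements of `S` (or acts on a single orbit) and fixes every other integer. -/
structure IsReflection (m : ℕ) (S : Set ℤ) (t : Equiv.Perm ℤ) : Prop where
  comm : ∀ g ∈ Gm m, ∀ x, t (g x) = g (t x)
  invol : ∀ x, t (t x) = x
  orbit : ∀ x y, t x ≠ x → t y ≠ y → GmRel m x y ∨ GmRel m (t x) y
  mem : ∀ x, t x ≠ x → x ∈ S
  ne : ∃ x, t x ≠ x

namespace IsReflection

variable {m : ℕ} {S : Set ℤ} {s t : Equiv.Perm ℤ}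

theorem map_ne (ht : IsReflection m S t) {x : ℤ} (hx : t x ≠ x) : t (t x) ≠ t x := by
  rw [ht.invol]; exact hx.symm

theorem map_mem (ht : IsReflection m S t) {x : ℤ} (hx : x ∈ S) : t x ∈ S := by
  by_cases h : t x = x
  · rwa [h]
  · exact ht.mem _ (ht.map_ne h)

theorem exists_lt (ht : IsReflection m S t) : ∃ x, x < t x := by
  obtain ⟨x, hx⟩ := ht.ne
  rcases lt_or_gt_of_ne hx with h | h
  · exact ⟨t x, by rwa [ht.invol]⟩
  · exact ⟨x, h⟩

theorem eq_of_apply_eq (hs : IsReflection m S s) (ht : IsReflection m S t) {x : ℤ} (hx : s x ≠ x)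
    (h : t x = s x) : s = t := by
  have hx' : t x ≠ x := h ▸ hx
  have h' : t (s x) = x := by rw [← h, ht.invol]
  have key : ∀ y, (GmRel m x y ∨ GmRel m (s x) y) → s y = t y := by
    rintro y (⟨g, hg, rfl⟩ | ⟨g, hg, rfl⟩)
    · rw [hs.comm g hg, ht.comm g hg, h]
    · rw [hs.comm g hg, ht.comm g hg, hs.invol, h']
  ext y
  by_cases h1 : s y = y
  · by_cases h2 : t y = y
    · rw [h1, h2]
    · exact key y (h ▸ ht.orbit x y hx' h2)
  · exact key y (hs.orbit x y hx h1)

theorem conj (hs : IsReflection m S s) (ht : IsReflection m S t) :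
    IsReflection m S (s * t * s) where
  comm g hg x := by simp only [Equiv.Perm.mul_apply, hs.comm g hg, ht.comm g hg]
  invol x := by simp only [Equiv.Perm.mul_apply, hs.invol, ht.invol]
  orbit x y hx hy := by
    simp only [Equiv.Perm.mul_apply] at *
    have hx' : t (s x) ≠ s x := fun h => hx (by rw [h, hs.invol])
    have hy' : t (s y) ≠ s y := fun h => hy (by rw [h, hs.invol])
    rcases ht.orbit _ _ hx' hy' with ⟨g, hg, h⟩ | ⟨g, hg, h⟩
    · exact Or.inl ⟨g, hg, s.injective (by rw [hs.comm g hg, h])⟩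
    · exact Or.inr ⟨g, hg, s.injective (by rw [hs.comm g hg, hs.invol, h])⟩
  mem x hx := by
    simp only [Equiv.Perm.mul_apply] at hx
    have := hs.map_mem (ht.mem (s x) fun h => hx (by rw [h, hs.invol]))
    rwa [hs.invol] at this
  ne := by
    obtain ⟨x, hx⟩ := ht.ne
    refine ⟨s x, ?_⟩
    simpa only [Equiv.Perm.mul_apply, hs.invol] using fun h => hx (s.injective h)

/-- No element of `S` lies strictly between a point and its image. -/
def IsSimple (S : Set ℤ) (s : Equiv.Perm ℤ) : Prop :=
  ∀ x y, x < y → y < s x → y ∉ S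

theorem IsSimple.lt_map (hs : IsReflection m S s) (hS : IsSimple S s) {x y : ℤ} (hx : x ∈ S)
    (hy : y ∈ S) (hxy : x < y) (hne : y ≠ s x) : s x < s y := by
  have h1 := hS x y hxy
  have h2 : s y < x → x < y → False := fun h h' => hS (s y) x h (by rwa [hs.invol]) hx
  have h3 : x < s y → s y < s x → False := fun h h' => hS x (s y) h h' (hs.map_mem hy)
  have h4 : s x ≠ s y := fun h => hxy.ne (s.injective h)
  have h5 : s y ≠ x := fun h => hne (by rw [← h, hs.invol])
  by_contra hcon
  have h6 : ¬ y < s x := fun h => h1 h hy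
  have h7 : ¬ s y < x := fun h => h2 h hxy
  have h8 : ¬ s y < s x := fun h => h3 (by omega) h
  omega

end IsReflection

/-- The basis elements of the pong algebra with domain `S`, as functions on `ℤ`. -/
def LPP (m k : ℕ) (S : Set ℤ) : Type := {f : ℤ → ℤ // IsLPP m k S f ∧ ∀ x ∉ S, f x = x}

/-- The reflections of `S`, as a type. -/
def SetReflection (m : ℕ) (S : Set ℤ) : Type := {t : Equiv.Perm ℤ // IsReflection m S t}

/-- The crossing reflections of `f`. -/
def inversions (m : ℕ) (S : Set ℤ) (f : ℤ → ℤ) : Set (SetReflection m S) :=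
  {t | ∃ x, x < t.1 x ∧ f (t.1 x) < f x}

section Lifted

variable {m k : ℕ} {S : Set ℤ} {f : ℤ → ℤ}

theorem IsLPP.injOn (hf : IsLPP m k S f) : Set.InjOn f S := by
  intro x hx y hy h
  obtain ⟨g, hg, rfl⟩ := hf.inj x hx y hy ⟨1, one_mem _, h⟩
  rw [hf.equivariant g hg x hx] at h
  rw [Gm_eq_one hg h.symm, Equiv.Perm.one_apply]

theorem IsLPP.comp (hf : IsLPP m k S f) {t : Equiv.Perm ℤ} (ht : IsReflection m S t) :
    IsLPP m k S (f ∘ t) where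
  invariant := hf.invariant
  equivariant g hg x hx := by
    simp only [Function.comp_apply, ht.comm g hg, hf.equivariant g hg _ (ht.map_mem hx)]
  orbits := hf.orbits
  inj x hx y hy h := by
    obtain ⟨g, hg, h⟩ := hf.inj _ (ht.map_mem hx) _ (ht.map_mem hy) h
    exact ⟨g, hg, t.injective (by rw [ht.comm g hg, h])⟩

/-- Whether a reflection is crossing can be tested at any moved point. -/
theorem IsLPP.crossing_iff (hf : IsLPP m k S f) {t : Equiv.Perm ℤ} (ht : IsReflection m S t)
    {x y : ℤ} (hx : x < t x) (hy : y < t y) : f (t x) < f x ↔ f (t y) < f y := by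
  have hxS := ht.mem x hx.ne'
  have htS := ht.map_mem hxS
  rcases ht.orbit x y hx.ne' hy.ne' with ⟨g, hg, rfl⟩ | ⟨g, hg, rfl⟩
  · rw [ht.comm g hg] at hy ⊢
    rw [hf.equivariant g hg _ hxS, hf.equivariant g hg _ htS]
    obtain ⟨a, h | h⟩ := Gm_add_or_sub hg <;> simp only [h] at hy ⊢ <;> omega
  · rw [ht.comm g hg, ht.invol] at hy ⊢
    rw [hf.equivariant g hg _ hxS, hf.equivariant g hg _ htS]
    obtain ⟨a, h | h⟩ := Gm_add_or_sub hg <;> simp only [h] at hy ⊢ <;> omega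

theorem IsLPP.mem_inversions_iff (hf : IsLPP m k S f) {t : SetReflection m S} {x : ℤ}
    (hx : x < t.1 x) : t ∈ inversions m S f ↔ f (t.1 x) < f x :=
  ⟨fun ⟨_, hy, h⟩ => (hf.crossing_iff t.2 hy hx).1 h, fun h => ⟨x, hx, h⟩⟩

theorem IsLPP.mem_inversions_comp_self (hf : IsLPP m k S f) (t : SetReflection m S) :
    t ∈ inversions m S (f ∘ t.1) ↔ t ∉ inversions m S f := by
  obtain ⟨x, hx⟩ := t.2.exists_lt
  rw [hf.mem_inversions_iff hx, (hf.comp t.2).mem_inversions_iff hx]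
  simp only [Function.comp_apply, t.2.invol]
  have hxS := t.2.mem x hx.ne'
  have : f x ≠ f (t.1 x) := fun h => hx.ne (hf.injOn hxS (t.2.map_mem hxS) h)
  omega

/-- Conjugation of reflections of `S`. -/
def SetReflection.conj (s t : SetReflection m S) : SetReflection m S :=
  ⟨s.1 * t.1 * s.1, s.2.conj t.2⟩

theorem conj_mem_inversions {s t : SetReflection m S} (hs : IsReflection.IsSimple S s.1)
    (ht : t ∈ inversions m S f) (hne : t ≠ s) :
    SetReflection.conj s t ∈ inversions m S (f ∘ s.1) := by
  obtain ⟨x, hx, hfx⟩ := ht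
  have hxS := t.2.mem x hx.ne'
  refine ⟨s.1 x, ?_, ?_⟩
  · simp only [SetReflection.conj, Equiv.Perm.mul_apply, s.2.invol]
    refine IsReflection.IsSimple.lt_map s.2 hs hxS (t.2.map_mem hxS) hx fun h => hne ?_
    exact Subtype.ext (t.2.eq_of_apply_eq s.2 hx.ne' h.symm)
  · simpa only [SetReflection.conj, Equiv.Perm.mul_apply, Function.comp_apply, s.2.invol] using hfx

theorem exists_bound (hm : 2 ≤ m) (hf : IsLPP m k S f) : ∃ B : ℤ, ∀ x ∈ S, |f x - x| ≤ B := by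
  obtain ⟨B, hB⟩ := ((Set.finite_Ico (0 : ℤ) (2 * m - 2)).image fun x => |f x - x|).bddAbove
  refine ⟨B, fun x hx => ?_⟩
  obtain ⟨g, hg, h, hmem⟩ := exists_Gm_emod hm x
  have := hB ⟨g x, hmem, rfl⟩
  simp only [hf.equivariant g hg x hx] at this
  rw [h, h] at this
  rwa [sub_sub_sub_cancel_right] at this

theorem finite_inversions (hm : 2 ≤ m) (hf : IsLPP m k S f) : (inversions m S f).Finite := by
  obtain ⟨B, hB⟩ := exists_bound hm hf
  have key : ∀ t : SetReflection m S, t ∈ inversions m S f →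
      ∃ x, x ∈ Set.Ico (0 : ℤ) (2 * m - 2) ∧ x < t.1 x ∧ t.1 x ∈ Set.Icc 0 (2 * m + 2 * B) := by
    rintro t ⟨y, hy, hfy⟩
    obtain ⟨g, hg, h, hmem⟩ := exists_Gm_emod hm y
    have hyS := t.2.mem y hy.ne'
    refine ⟨g y, hmem, ?_, ?_⟩
    · rw [t.2.comm g hg, h, h]; omega
    · have h1 := abs_le.1 (hB y hyS)
      have h2 := abs_le.1 (hB _ (t.2.map_mem hyS))
      rw [t.2.comm g hg]
      rw [Set.mem_Ico] at hmem
      rw [Set.mem_Icc]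
      rw [h] at hmem ⊢
      omega
  choose! x hx using key
  refine Set.Finite.of_finite_image (f := fun t => (x t, t.1 (x t))) ?_ ?_
  · refine ((Set.finite_Ico (0 : ℤ) (2 * m - 2)).prod
      (Set.finite_Icc (0 : ℤ) (2 * m + 2 * B))).subset ?_
    rintro _ ⟨t, ht, rfl⟩
    exact ⟨(hx t ht).1, (hx t ht).2.2⟩
  · intro t ht u hu h
    simp only [Prod.mk.injEq] at h
    refine Subtype.ext (t.2.eq_of_apply_eq u.2 (hx t ht).2.1.ne' ?_)
    rw [h.2, h.1]

theorem IsCrossing.swap (hf : IsLPP m k S f) {i j : ℤ} (h : IsCrossing S f i j)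
    {g : Equiv.Perm ℤ} (hg : g ∈ Gm m) (hij : g i = j) : g j = i := by
  obtain ⟨hi, hj, hlt, hflt⟩ := h
  have := hf.equivariant g hg i hi
  rw [hij] at this
  obtain ⟨a, h | h⟩ := Gm_add_or_sub hg <;> simp only [h] at * <;> omega

theorem resolveFun_left {i j : ℤ} {g : Equiv.Perm ℤ} (hg : g ∈ Gm m) :
    resolveFun m f i j (g i) = g (f j) := by
  have h : ∃ h ∈ Gm m, h i = g i := ⟨g, hg, rfl⟩
  rw [resolveFun, dif_pos h, Gm_ext h.choose_spec.1 hg h.choose_spec.2]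

theorem resolveFun_right {i j : ℤ} (hij : ∀ g ∈ Gm m, g i = j → g j = i ∧ g (f j) = f i)
    {g : Equiv.Perm ℤ} (hg : g ∈ Gm m) : resolveFun m f i j (g j) = g (f i) := by
  by_cases h : ∃ h ∈ Gm m, h i = g j
  · obtain ⟨c, hc, h⟩ := h
    rw [← h, resolveFun_left hc]
    have := (hij (g⁻¹ * c) (mul_mem (inv_mem hg) hc) (by simp [h])).2
    rwa [Equiv.Perm.mul_apply, Equiv.Perm.inv_eq_iff_eq] at this
  · have h' : ∃ h ∈ Gm m, h j = g j := ⟨g, hg, rfl⟩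
    rw [resolveFun, dif_neg h, dif_pos h', Gm_ext h'.choose_spec.1 hg h'.choose_spec.2]

theorem resolveFun_of_not {i j x : ℤ} (hi : ¬ GmRel m i x) (hj : ¬ GmRel m j x) :
    resolveFun m f i j x = f x := by
  exact (dif_neg hi).trans (dif_neg hj)

/-- Resolving a crossing is precomposition with a reflection. -/
theorem IsCrossing.exists_refl (hf : IsLPP m k S f) {i j : ℤ} (h : IsCrossing S f i j) :
    ∃ t : SetReflection m S, t.1 i = j ∧ resolveFun m f i j = f ∘ t.1 := by
  have hswap : ∀ g ∈ Gm m, g i = j → g j = i := fun g hg => h.swap hf hg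
  set τ : ℤ → ℤ := resolveFun m id i j with hτ
  have hl : ∀ g ∈ Gm m, τ (g i) = g j := fun g hg => resolveFun_left hg
  have hr : ∀ g ∈ Gm m, τ (g j) = g i := fun g hg =>
    resolveFun_right (fun g hg h => ⟨hswap g hg h, hswap g hg h⟩) hg
  have ho : ∀ x, ¬ GmRel m i x → ¬ GmRel m j x → τ x = x := fun x => resolveFun_of_not
  have hcases : ∀ x, (∃ g ∈ Gm m, g i = x) ∨ (∃ g ∈ Gm m, g j = x) ∨
      (¬ GmRel m i x ∧ ¬ GmRel m j x) := by
    intro x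
    by_cases h1 : GmRel m i x
    · exact Or.inl h1
    · by_cases h2 : GmRel m j x
      · exact Or.inr (Or.inl h2)
      · exact Or.inr (Or.inr ⟨h1, h2⟩)
  have hinv : Function.Involutive τ := by
    intro x
    rcases hcases x with ⟨g, hg, rfl⟩ | ⟨g, hg, rfl⟩ | ⟨h1, h2⟩
    · rw [hl g hg, hr g hg]
    · rw [hr g hg, hl g hg]
    · rw [ho x h1 h2, ho x h1 h2]
  have hτi : τ i = j := hl 1 (one_mem _)
  have hmoved : ∀ x, τ x ≠ x → GmRel m i x ∨ GmRel m j x := by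
    intro x hx
    by_contra hcon
    rw [not_or] at hcon
    exact hx (ho x hcon.1 hcon.2)
  have trans : ∀ {a b c : ℤ}, GmRel m a b → GmRel m a c → GmRel m b c := by
    rintro a b c ⟨g, hg, rfl⟩ ⟨g', hg', rfl⟩
    exact ⟨g' * g⁻¹, mul_mem hg' (inv_mem hg), by simp⟩
  refine ⟨⟨hinv.toPerm τ, ?_⟩, hτi, ?_⟩
  · refine ⟨fun c hc x => ?_, hinv, fun x y hx hy => ?_, fun x hx => ?_, i, ?_⟩
    · simp only [Function.Involutive.coe_toPerm]
      rcases hcases x with ⟨g, hg, rfl⟩ | ⟨g, hg, rfl⟩ | ⟨h1, h2⟩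
      · rw [hl g hg]; exact hl (c * g) (mul_mem hc hg)
      · rw [hr g hg]; exact hr (c * g) (mul_mem hc hg)
      · have aux : ∀ a, ¬ GmRel m a x → ¬ GmRel m a (c x) := by
          rintro a ha ⟨g, hg, h⟩
          exact ha ⟨c⁻¹ * g, mul_mem (inv_mem hc) hg, by simp [h]⟩
        rw [ho x h1 h2, ho _ (aux i h1) (aux j h2)]
    · simp only [Function.Involutive.coe_toPerm] at *
      rcases hmoved x hx with ⟨g, hg, rfl⟩ | ⟨g, hg, rfl⟩
      · rw [hl g hg]
        exact (hmoved y hy).imp (trans ⟨g, hg, rfl⟩) (trans ⟨g, hg, rfl⟩)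
      · rw [hr g hg]
        exact (hmoved y hy).symm.imp (trans ⟨g, hg, rfl⟩) (trans ⟨g, hg, rfl⟩)
    · rcases hmoved x hx with ⟨g, hg, rfl⟩ | ⟨g, hg, rfl⟩
      · exact hf.invariant g hg _ h.1
      · exact hf.invariant g hg _ h.2.1
    · rw [Function.Involutive.coe_toPerm, hτi]; exact h.2.2.1.ne'
  · funext x
    rw [Function.comp_apply, Function.Involutive.coe_toPerm]
    rcases hcases x with ⟨g, hg, rfl⟩ | ⟨g, hg, rfl⟩ | ⟨h1, h2⟩
    · rw [hl g hg, resolveFun_left hg, hf.equivariant g hg _ h.2.1]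
    · rw [hr g hg, hf.equivariant g hg _ h.1]
      refine resolveFun_right (fun c hc hcij => ⟨hswap c hc hcij, ?_⟩) hg
      rw [← hf.equivariant c hc _ h.2.1, hswap c hc hcij]
    · rw [ho x h1 h2, resolveFun_of_not h1 h2]

/-- The pairs exchanged by a reflection. -/
def SetReflection.pairs (t : SetReflection m S) : Set (Set ℤ) :=
  {A | ∃ x, t.1 x ≠ x ∧ A = {x, t.1 x}}

theorem SetReflection.pairs_injective :
    Function.Injective (SetReflection.pairs (m := m) (S := S)) := by
  intro t u h
  obtain ⟨x, hx⟩ := t.2.ne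
  have : ({x, t.1 x} : Set ℤ) ∈ u.pairs := h ▸ ⟨x, hx, rfl⟩
  obtain ⟨y, hy, hxy⟩ := this
  refine Subtype.ext (t.2.eq_of_apply_eq u.2 hx ?_)
  rcases Set.pair_eq_pair_iff.1 hxy with ⟨rfl, h⟩ | ⟨rfl, h⟩
  · exact h.symm
  · rw [u.2.invol, h]

theorem SetReflection.pairOrbit_eq (t : SetReflection m S) {i : ℤ} (hi : t.1 i ≠ i) :
    pairOrbit m (i, t.1 i) = t.pairs := by
  ext A
  constructor
  · rintro ⟨g, hg, rfl⟩
    refine ⟨g i, ?_, ?_⟩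
    · rw [t.2.comm g hg]; exact fun h => hi (g.injective h)
    · rw [t.2.comm g hg]
  · rintro ⟨x, hx, rfl⟩
    rcases t.2.orbit i x hi hx with ⟨g, hg, rfl⟩ | ⟨g, hg, rfl⟩
    · exact ⟨g, hg, by rw [t.2.comm g hg]⟩
    · exact ⟨g, hg, by rw [t.2.comm g hg, t.2.invol, Set.pair_comm]⟩

theorem image_pairOrbit (hf : IsLPP m k S f) (Q : (ℤ → ℤ) → Prop) :
    pairOrbit m '' {p : ℤ × ℤ | IsCrossing S f p.1 p.2 ∧ Q (resolveFun m f p.1 p.2)} =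
      SetReflection.pairs '' {t : SetReflection m S | t ∈ inversions m S f ∧ Q (f ∘ t.1)} := by
  ext A
  constructor
  · rintro ⟨⟨i, j⟩, ⟨hc, hQ⟩, rfl⟩
    simp only at hc hQ
    obtain ⟨t, rfl, ht⟩ := hc.exists_refl hf
    exact ⟨t, ⟨⟨i, hc.2.2.1, hc.2.2.2⟩, ht ▸ hQ⟩, (t.pairOrbit_eq hc.2.2.1.ne').symm⟩
  · rintro ⟨t, ⟨⟨x, hx, hfx⟩, hQ⟩, rfl⟩
    have hxS := t.2.mem x hx.ne'
    have hc : IsCrossing S f x (t.1 x) := ⟨hxS, t.2.map_mem hxS, hx, hfx⟩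
    refine ⟨(x, t.1 x), ⟨hc, ?_⟩, t.pairOrbit_eq hx.ne'⟩
    obtain ⟨u, hu, hr⟩ := hc.exists_refl hf
    have : t = u := Subtype.ext (t.2.eq_of_apply_eq u.2 hx.ne' hu)
    simp only [hr]
    rwa [← this]

theorem crossCount_eq (hf : IsLPP m k S f) : crossCount m S f = (inversions m S f).ncard := by
  have := image_pairOrbit hf fun _ => True
  simp only [and_true, Set.ofPred_mem_eq] at this
  rw [crossCount, crossings, this, Set.ncard_image_of_injective _ SetReflection.pairs_injective]

theorem exists_simple_inversion (hf : IsLPP m k S f) (h : (inversions m S f).Nonempty) :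
    ∃ s ∈ inversions m S f, IsReflection.IsSimple S s.1 := by
  have hex : ∃ d : ℕ, ∃ i j, IsCrossing S f i j ∧ j - i = d := by
    obtain ⟨t, x, hx, hfx⟩ := h
    have hxS := t.2.mem x hx.ne'
    exact ⟨(t.1 x - x).toNat, x, t.1 x, ⟨hxS, t.2.map_mem hxS, hx, hfx⟩, by omega⟩
  obtain ⟨i, j, hc, hd⟩ := Nat.find_spec hex
  have hmin : ∀ i' j', IsCrossing S f i' j' → j - i ≤ j' - i' := by
    intro i' j' hc'
    have h1 : i' < j' := hc'.2.2.1
    have := Nat.find_min' hex ⟨i', j', hc', show j' - i' = (j' - i').toNat by omega⟩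
    omega
  obtain ⟨t, rfl, -⟩ := hc.exists_refl hf
  obtain ⟨hi, hj, hlt, hflt⟩ := hc
  have hadj : ∀ l, i < l → l < t.1 i → l ∉ S := by
    intro l h1 h2 hl
    by_cases h3 : f l < f i
    · have := hmin i l ⟨hi, hl, h1, h3⟩; omega
    · have := hmin l _ ⟨hl, hj, h2, by omega⟩; omega
  refine ⟨t, ⟨i, hlt, hflt⟩, fun x y hxy hyx hy => ?_⟩
  rcases t.2.orbit i x hlt.ne' (by omega) with ⟨g, hg, rfl⟩ | ⟨g, hg, rfl⟩
  · rw [t.2.comm g hg] at hyx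
    have hy' := hf.invariant _ (inv_mem hg) y hy
    have hgy : g (g⁻¹ y) = y := by simp
    obtain ⟨a, h | h⟩ := Gm_add_or_sub hg <;> rw [h] at hxy hyx hgy <;>
      exact hadj _ (by omega) (by omega) hy'
  · rw [t.2.comm g hg, t.2.invol] at hyx
    have hy' := hf.invariant _ (inv_mem hg) y hy
    have hgy : g (g⁻¹ y) = y := by simp
    obtain ⟨a, h | h⟩ := Gm_add_or_sub hg <;> rw [h] at hxy hyx hgy <;>
      exact hadj _ (by omega) (by omega) hy'

/-- The inversion system of the lifted partial permutations with domain `S`. -/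
def pongSystem (hm : 2 ≤ m) (k : ℕ) (S : Set ℤ) :
    InversionSystem (LPP m k S) (SetReflection m S) where
  act x t := ⟨x.1 ∘ t.1, x.2.1.comp t.2, fun y hy => by
    have : t.1 y = y := not_not.1 fun h => hy (t.2.mem y h)
    rw [Function.comp_apply, this, x.2.2 y hy]⟩
  conj := SetReflection.conj
  N x := (finite_inversions hm x.2.1).toFinset
  simple s := IsReflection.IsSimple S s.1
  act_act x t := Subtype.ext <| funext fun y => by simp [t.2.invol]
  act_conj x s t := Subtype.ext <| funext fun y => by simp [SetReflection.conj, s.2.invol]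
  conj_conj s t := Subtype.ext <| Equiv.ext fun y => by simp [SetReflection.conj, s.2.invol]
  conj_self s := Subtype.ext <| Equiv.ext fun y => by simp [SetReflection.conj, s.2.invol]
  conj_mem x s t hs ht hne := by
    rw [Set.Finite.mem_toFinset] at *
    exact conj_mem_inversions hs ht hne
  self_mem x s := by
    simp only [Set.Finite.mem_toFinset]
    exact x.2.1.mem_inversions_comp_self s
  exists_simple x h := by
    simpa only [Set.Finite.mem_toFinset] using
      exists_simple_inversion x.2.1 ((Set.Finite.toFinset_nonempty _).1 h)

theorem pongSystem_len (hm : 2 ≤ m) (x : LPP m k S) :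
    (pongSystem hm k S).len x = crossCount m S x.1 := by
  rw [crossCount_eq x.2.1, Set.ncard_eq_toFinset_card _ (finite_inversions hm x.2.1)]
  rfl

theorem LPP.ext_on {x y : LPP m k S} (h : Set.EqOn x.1 y.1 S) : x = y := by
  refine Subtype.ext (funext fun z => ?_)
  by_cases hz : z ∈ S
  · exact h hz
  · rw [x.2.2 z hz, y.2.2 z hz]

theorem pongSystem_d_apply (hm : 2 ≤ m) (x y : LPP m k S) :
    (pongSystem hm k S).d x y = ((resCrossSet m S x.1 y.1).ncard : ZMod 2) := by
  have := image_pairOrbit x.2.1 fun f' => Set.EqOn f' y.1 S ∧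
    crossCount m S f' + 1 = crossCount m S x.1
  rw [InversionSystem.d_apply, resCrossSet, this,
    Set.ncard_image_of_injective _ SetReflection.pairs_injective, ← Set.ncard_coe_finset]
  congr 2
  ext t
  simp only [InversionSystem.covers, Finset.coe_filter, Finset.mem_filter, pongSystem_len,
    Set.mem_ofPred_eq]
  have h1 : t ∈ (pongSystem hm k S).N x ↔ t ∈ inversions m S x.1 := Set.Finite.mem_toFinset _
  have h2 : (pongSystem hm k S).act x t = y ↔ Set.EqOn (x.1 ∘ t.1) y.1 S :=
    ⟨fun h => h ▸ fun _ _ => rfl, fun h => LPP.ext_on h⟩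
  rw [h1, h2, and_assoc, and_comm (a := crossCount _ _ _ + 1 = _)]
  rfl

end Lifted

section Weight

variable {m k : ℕ} {S : Set ℤ} {f : ℤ → ℤ}

theorem weightSet_eq (j : ℤ) (S : Set ℤ) (f : ℤ → ℤ) :
    weightSet j S f = {x | x ∈ S ∧ ¬ (x < j ↔ f x < j)} := by
  have h1 : ∀ a : ℤ, (a : ℚ) < (j : ℚ) - 1 / 2 ↔ a < j := by
    intro a
    constructor
    · intro h
      have : (a : ℚ) < j := by linarith
      exact_mod_cast this
    · intro h
      have : (a : ℚ) + 1 ≤ j := by exact_mod_cast h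
      linarith
  have h2 : ∀ a : ℤ, (j : ℚ) - 1 / 2 < (a : ℚ) ↔ ¬ a < j := by
    intro a
    rw [← h1, not_lt]
    refine ⟨le_of_lt, fun h => lt_of_le_of_ne h fun h' => ?_⟩
    have : (2 * j - 1 : ℚ) = 2 * a := by linarith
    have : 2 * j - 1 = 2 * a := by exact_mod_cast this
    omega
  ext x
  simp only [weightSet, Set.mem_ofPred_eq, h1, h2]
  tauto

theorem finite_weightSet (hm : 2 ≤ m) (hf : IsLPP m k S f) (j : ℤ) :
    (weightSet j S f).Finite := by
  obtain ⟨B, hB⟩ := exists_bound hm hf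
  refine (Set.finite_Icc (j - B) (j + B)).subset fun x hx => ?_
  rw [weightSet_eq] at hx
  have h1 := abs_le.1 (hB x hx.1)
  have h2 := hx.2
  rw [Set.mem_Icc]
  omega

/-- Resolving a crossing lowers the weight by an integer. -/
theorem ncard_weightSet_comp (hm : 2 ≤ m) (hf : IsLPP m k S f) {t : SetReflection m S}
    (ht : t ∈ inversions m S f) (j : ℤ) : ∃ n : ℕ,
    (weightSet j S f).ncard = (weightSet j S (f ∘ t.1)).ncard + 2 * n := by
  have hcross : ∀ x, x < t.1 x → f (t.1 x) < f x := fun x hx => (hf.mem_inversions_iff hx).1 ht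
  have hcross' : ∀ x, t.1 x < x → f x < f (t.1 x) := fun x hx => by
    simpa only [t.2.invol] using hcross (t.1 x) (by rwa [t.2.invol])
  have hfin := finite_weightSet hm hf j
  -- the left endpoints of the strands through the crossing which both straddle the wall
  set E : Set ℤ := {x | x ∈ S ∧ x < j ∧ ¬ t.1 x < j ∧ ¬ f x < j ∧ f (t.1 x) < j} with hE
  set W := weightSet j S f with hW
  have hWmem : ∀ x, x ∈ W ↔ x ∈ S ∧ ¬ (x < j ↔ f x < j) := fun x => by
    rw [hW, weightSet_eq]; rfl
  have hES : E ⊆ W := fun x hx => by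
    rw [hWmem]; simp only [hE, Set.mem_ofPred_eq] at hx; tauto
  have htE : t.1 '' E ⊆ W := by
    rintro _ ⟨x, hx, rfl⟩
    rw [hWmem]; simp only [hE, Set.mem_ofPred_eq] at hx
    have := t.2.map_mem hx.1
    tauto
  have hdisj : Disjoint E (t.1 '' E) := by
    rw [Set.disjoint_right]
    rintro _ ⟨x, hx, rfl⟩ hx'
    exact hx.2.2.1 hx'.2.1
  set σ : ℤ → ℤ := fun x => if (x < j ↔ t.1 x < j) then t.1 x else x with hσ
  have hσσ : Function.Involutive σ := by
    intro x
    by_cases h : (x < j ↔ t.1 x < j)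
    · simp only [hσ, h, if_true, t.2.invol]
    · simp only [hσ, h, if_false]
  have himage : weightSet j S (f ∘ t.1) = σ '' (W \ (E ∪ t.1 '' E)) := by
    rw [hσσ.image_eq_preimage_symm]
    ext x
    have hmem : ∀ y, y ∈ t.1 '' E ↔ t.1 y ∈ E := fun y =>
      ⟨by rintro ⟨z, hz, rfl⟩; rwa [t.2.invol], fun h => ⟨_, h, t.2.invol y⟩⟩
    have hS : t.1 x ∈ S ↔ x ∈ S :=
      ⟨fun h => by simpa only [t.2.invol] using t.2.map_mem h, t.2.map_mem⟩
    simp only [weightSet_eq, Set.mem_preimage, Set.mem_sdiff, Set.mem_union, hmem, hWmem, hσ,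
      Function.comp_apply]
    have c1 := hcross x
    have c2 := hcross' x
    by_cases h : (x < j ↔ t.1 x < j)
    · simp only [h, if_true, hE, Set.mem_ofPred_eq, t.2.invol, hS]
      tauto
    · simp only [h, if_false, hE, Set.mem_ofPred_eq, t.2.invol, hS]
      by_cases hxS : x ∈ S
      · simp only [hxS, true_and]
        omega
      · simp [hxS]
  refine ⟨E.ncard, ?_⟩
  have h1 := Set.ncard_sdiff_add_ncard_of_subset (Set.union_subset hES htE) hfin
  rw [Set.ncard_union_eq hdisj (hfin.subset hES) (hfin.subset htE),
    Set.ncard_image_of_injective _ t.1.injective] at h1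
  rw [himage, Set.ncard_image_of_injective _ hσσ.injective]
  omega

theorem exists_of_d_ne_zero (hm : 2 ≤ m) {x y : LPP m k S}
    (h : (pongSystem hm k S).d x y ≠ 0) (j : ℤ) :
    ∃ n : ℕ, (weightSet j S x.1).ncard = (weightSet j S y.1).ncard + 2 * n := by
  rw [InversionSystem.d_apply] at h
  obtain ⟨t, ht⟩ := Finset.card_ne_zero.1 fun h' => h (by rw [h', Nat.cast_zero])
  simp only [InversionSystem.covers, Finset.mem_filter] at ht
  rw [← ht.2]
  exact ncard_weightSet_comp hm x.2.1 ((Set.Finite.mem_toFinset _).1 ht.1.1) j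

theorem expDiff_add (hm : 2 ≤ m) {x y z : LPP m k S} (hxy : (pongSystem hm k S).d x y ≠ 0)
    (hyz : (pongSystem hm k S).d y z ≠ 0) :
    expDiff m S x.1 y.1 + expDiff m S y.1 z.1 = expDiff m S x.1 z.1 := by
  ext l
  obtain ⟨a, ha⟩ := exists_of_d_ne_zero hm hxy ((l : ℕ) + 1)
  obtain ⟨b, hb⟩ := exists_of_d_ne_zero hm hyz ((l : ℕ) + 1)
  simp only [expDiff, Finsupp.add_apply, Finsupp.equivFunOnFinite_symm_apply_apply]
  omega

end Weight

/-- The basis element of the pong algebra given by a function with domain `S`. -/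
def LPP.toPongIdx {m k : ℕ} {S : Set ℤ} (x : LPP m k S) : PongIdx m k := ⟨(S, x.1), x.2⟩

theorem LPP.toPongIdx_injective {m k : ℕ} {S : Set ℤ} :
    Function.Injective (LPP.toPongIdx (m := m) (k := k) (S := S)) := fun _ _ h =>
  Subtype.ext (congrArg (fun p : PongIdx m k => p.1.2) h)

theorem Mdiff_toPongIdx {m k : ℕ} {S : Set ℤ} (hm : 2 ≤ m) (x y : LPP m k S) :
    Mdiff m k x.toPongIdx y.toPongIdx =
      MvPolynomial.monomial (expDiff m S x.1 y.1) ((pongSystem hm k S).d x y) := by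
  rw [pongSystem_d_apply]
  exact if_pos rfl

theorem Mdiff_of_ne {m k : ℕ} {p q : PongIdx m k} (h : q.1.1 ≠ p.1.1) : Mdiff m k p q = 0 :=
  if_neg h

/-- The differential of the pong algebra squares to zero:
`∂ ∘ ∂ = 0` as a map `P(m, k) → P(m, k)`.  Since `P(m, k)` is the free
`F₂[v₁, …, v_m]`-module on the set of lifted partial permutations and `∂` is
linear with structure constants `Mdiff`, this says exactly that all matrix
coefficients of `∂ ∘ ∂` vanish. -/
theorem pong_d_squared_zero (m k : ℕ) (hm : 2 ≤ m) (hk0 : 0 < k) (hkm : k < m) :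
    ∀ p r : PongIdx m k,
      ∑ᶠ q : PongIdx m k, Mdiff m k p q * Mdiff m k q r = 0 := by
  intro p r
  obtain ⟨⟨S, f⟩, hf⟩ := p
  obtain ⟨⟨S', g⟩, hg⟩ := r
  by_cases hS : S' = S
  · subst hS
    let x : LPP m k S' := ⟨f, hf⟩
    let z : LPP m k S' := ⟨g, hg⟩
    change ∑ᶠ q : PongIdx m k, Mdiff m k x.toPongIdx q * Mdiff m k q z.toPongIdx = 0
    have hrange : ∀ q ∈ Function.support fun q : PongIdx m k =>
        Mdiff m k x.toPongIdx q * Mdiff m k q z.toPongIdx,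
        q ∈ Set.range (LPP.toPongIdx (m := m) (k := k) (S := S')) ↔ q ∈ Set.univ := by
      rintro ⟨⟨T, h⟩, hh⟩ hq
      have hT : T = S' := by
        by_contra hne
        exact left_ne_zero_of_mul hq (Mdiff_of_ne hne)
      subst hT
      exact ⟨fun _ => Set.mem_univ _, fun _ => ⟨⟨h, hh⟩, rfl⟩⟩
    rw [← finsum_mem_univ, ← finsum_mem_inter_support_eq' _ _ _ hrange,
      finsum_mem_range LPP.toPongIdx_injective]
    have hterm : ∀ y : LPP m k S',
        Mdiff m k x.toPongIdx y.toPongIdx * Mdiff m k y.toPongIdx z.toPongIdx =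
          MvPolynomial.monomial (expDiff m S' x.1 z.1)
            ((pongSystem hm k S').d x y * (pongSystem hm k S').d y z) := by
      intro y
      rw [Mdiff_toPongIdx hm, Mdiff_toPongIdx hm, MvPolynomial.monomial_mul]
      by_cases h1 : (pongSystem hm k S').d x y = 0
      · simp [h1]
      · by_cases h2 : (pongSystem hm k S').d y z = 0
        · simp [h2]
        · rw [expDiff_add hm h1 h2]
    have hfin : (Function.support fun y =>
        (pongSystem hm k S').d x y * (pongSystem hm k S').d y z).Finite :=
      ((pongSystem hm k S').d x).hasFiniteSupport.subset fun y hy => left_ne_zero_of_mul hy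
    have hmap := (MvPolynomial.monomial (R := ZMod 2)
      (expDiff m S' x.1 z.1)).toAddMonoidHom.map_finsum hfin
    rw [InversionSystem.finsum_d_mul_d, map_zero] at hmap
    rw [finsum_congr hterm]
    exact hmap.symm
  · refine finsum_eq_zero_of_forall_eq_zero fun q => ?_
    by_cases hq : q.1.1 = S
    · exact mul_eq_zero_of_right _ (Mdiff_of_ne fun h => hS (h.trans hq))
    · exact mul_eq_zero_of_left (Mdiff_of_ne hq) _
end
end

section
/- Let (S, f) and (T, g) be mℤ-lifted partial permutations on k letters with T = f(S). Then (S, g∘f) is an mℤ-lifted partial permutation on k letters, its set of crossings is finite, cross(g∘f) ≤ cross(f) + cross(g), and for every a ∈ 1/2 + ℤ, w_a(g∘f) ≤ w_a(f) + w_a(g). -/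
open scoped Classical BigOperators

noncomputable section

/-- `(S, f)` is an `mℤ`-lifted partial permutation on `k` letters. -/
structure IsALPP (m k : ℕ) (S : Set ℤ) (f : ℤ → ℤ) : Prop where
  invariant : ∀ x : ℤ, x ∈ S ↔ x + m ∈ S
  equivariant : ∀ x ∈ S, f (x + m) = f x + m
  orbits : ((fun x : ℤ => (x : ZMod m)) '' S).ncard = k
  inj : ∀ x ∈ S, ∀ y ∈ S, ((f x : ZMod m) = (f y : ZMod m)) → (x : ZMod m) = (y : ZMod m)

/-- Complete invariant of the `mℤ`-translation class of a pair `(i, j)`. -/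
def crossKeyA (m : ℕ) (p : ℤ × ℤ) : ZMod m × ℤ := ((p.1 : ZMod m), p.2 - p.1)

/-- The set of crossings of `(S, f)` (translation classes of crossing pairs). -/
def crossingsA (m : ℕ) (S : Set ℤ) (f : ℤ → ℤ) : Set (ZMod m × ℤ) :=
  crossKeyA m '' {p : ℤ × ℤ | IsCrossing S f p.1 p.2}

/-- The number of crossings. -/
def crossCountA (m : ℕ) (S : Set ℤ) (f : ℤ → ℤ) : ℕ := (crossingsA m S f).ncard

/-- The set whose cardinality (halved) is the weight `w_a(S, f)`,
for `a ∈ 1/2 + ℤ`. -/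
def weightSetA (a : ℚ) (S : Set ℤ) (f : ℤ → ℤ) : Set ℤ :=
  {i | i ∈ S ∧ (((i : ℚ) < a ∧ a < (f i : ℚ)) ∨ ((f i : ℚ) < a ∧ a < (i : ℚ)))}

/-- The weight `w_a(S, f)`. -/
def weightA (a : ℚ) (S : Set ℤ) (f : ℤ → ℤ) : ℚ := (weightSetA a S f).ncard / 2

/-- The resolution `f_{⟨i,j⟩}` of `f` at the crossing `⟨i, j⟩`. -/
def resolveA (m : ℕ) (f : ℤ → ℤ) (i j : ℤ) : ℤ → ℤ := fun x =>
  if (m : ℤ) ∣ (x - i) then f j + (x - i)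
  else if (m : ℤ) ∣ (x - j) then f i + (x - j)
  else f x

/-- The basis of the asteroids algebra: `mℤ`-lifted partial permutations,
normalized to be the identity off their domain. -/
def AstIdx (m k : ℕ) : Type :=
  {P : Set ℤ × (ℤ → ℤ) // IsALPP m k P.1 P.2 ∧ ∀ x ∉ P.1, P.2 x = x}

/-- The ground ring `F₂[v₁, …, v_m]` of the asteroids algebra. -/
abbrev AstRing (m : ℕ) := MvPolynomial (Fin m) (ZMod 2)

/-- The exponent vector `(w_{l-1/2}(f) - w_{l-1/2}(f'))_{l=1}^m` appearing in
the differential of the asteroids algebra. -/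
def expDiffA (m : ℕ) (S : Set ℤ) (f f' : ℤ → ℤ) : Fin m →₀ ℕ :=
  Finsupp.equivFunOnFinite.symm fun l =>
    ((weightSetA (((l : ℕ) : ℚ) + 1/2) S f).ncard
      - (weightSetA (((l : ℕ) : ℚ) + 1/2) S f').ncard) / 2

/-- The exponent vector for the product of the asteroids algebra. -/
def expMulA (m : ℕ) (S T : Set ℤ) (f g : ℤ → ℤ) : Fin m →₀ ℕ :=
  Finsupp.equivFunOnFinite.symm fun l =>
    ((weightSetA (((l : ℕ) : ℚ) + 1/2) S f).ncard
      + (weightSetA (((l : ℕ) : ℚ) + 1/2) T g).ncard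
      - (weightSetA (((l : ℕ) : ℚ) + 1/2) S (g ∘ f)).ncard) / 2

/-- Crossings of `(S, f)` whose resolution drops the crossing number by one
and agrees with `f'` on `S`. -/
def resCrossSetA (m : ℕ) (S : Set ℤ) (f f' : ℤ → ℤ) : Set (ZMod m × ℤ) :=
  crossKeyA m '' {p : ℤ × ℤ | IsCrossing S f p.1 p.2 ∧
    Set.EqOn (resolveA m f p.1 p.2) f' S ∧
    crossCountA m S (resolveA m f p.1 p.2) + 1 = crossCountA m S f}

/-- The structure constants of the differential of the asteroids algebra. -/
def MdiffA (m k : ℕ) (p q : AstIdx m k) : AstRing m :=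
  if q.1.1 = p.1.1 then
    MvPolynomial.monomial (expDiffA m p.1.1 p.1.2 q.1.2)
      ((resCrossSetA m p.1.1 p.1.2 q.1.2).ncard : ZMod 2)
  else 0

/-- The structure constants of the product of the asteroids algebra. -/
def MmulA (m k : ℕ) (p q s : AstIdx m k) : AstRing m :=
  if q.1.1 = p.1.2 '' p.1.1 ∧
      crossCountA m p.1.1 (q.1.2 ∘ p.1.2)
        = crossCountA m p.1.1 p.1.2 + crossCountA m q.1.1 q.1.2 ∧
      s.1.1 = p.1.1 ∧ Set.EqOn s.1.2 (q.1.2 ∘ p.1.2) p.1.1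
  then MvPolynomial.monomial (expMulA m p.1.1 q.1.1 p.1.2 q.1.2) 1
  else 0


namespace IsALPP

variable {m k : ℕ} {S T : Set ℤ} {f g : ℤ → ℤ}

/-- Invariance and equivariance under all translations by multiples of `m`. -/
theorem translate (hf : IsALPP m k S f) {x : ℤ} (hx : x ∈ S) (t : ℤ) :
    x + t * m ∈ S ∧ f (x + t * m) = f x + t * m := by
  induction t using Int.induction_on with
  | zero => simpa using hx
  | succ n ih =>
    have e : x + ((n : ℤ) + 1) * m = x + n * m + m := by ring
    rw [e]
    refine ⟨(hf.invariant _).1 ih.1, ?_⟩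
    rw [hf.equivariant _ ih.1, ih.2]
    ring
  | pred n ih =>
    have e : x + -(n : ℤ) * m = x + (-(n : ℤ) - 1) * m + m := by ring
    rw [e] at ih
    have h := (hf.invariant _).2 ih.1
    refine ⟨h, ?_⟩
    have h2 := hf.equivariant _ h
    rw [ih.2] at h2
    linarith

theorem exists_translate (hf : IsALPP m k S f) {x y : ℤ} (hx : x ∈ S)
    (h : (x : ZMod m) = y) : ∃ t : ℤ, y = x + t * m ∧ f y = f x + t * m := by
  obtain ⟨t, ht⟩ := (ZMod.intCast_eq_intCast_iff_dvd_sub x y m).1 h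
  have hy : y = x + t * m := by linarith
  exact ⟨t, hy, hy ▸ (hf.translate hx t).2⟩

theorem injOn (hf : IsALPP m k S f) : Set.InjOn f S := by
  intro x hx y hy h
  obtain ⟨t, hxy, hfxy⟩ := hf.exists_translate hx (hf.inj x hx y hy (by rw [h]))
  linarith

theorem exists_displacement_bound (hm : 1 ≤ m) (hf : IsALPP m k S f) :
    ∃ C : ℤ, ∀ x ∈ S, |f x - x| ≤ C := by
  obtain ⟨C, hC⟩ := ((Set.finite_Icc (0 : ℤ) m).image fun x => |f x - x|).bddAbove
  refine ⟨C, fun x hx => ?_⟩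
  have hm' : (0 : ℤ) < m := by exact_mod_cast hm
  obtain ⟨-, h⟩ := hf.translate hx (-(x / m))
  have e : x + -(x / m) * m = x % m := by
    have := Int.emod_add_mul_ediv x m
    linarith
  have key : f x - x = f (x % m) - x % m := by
    rw [e] at h
    linarith
  rw [key]
  exact hC ⟨x % m, ⟨Int.emod_nonneg _ hm'.ne', (Int.emod_lt_of_pos _ hm').le⟩, rfl⟩

theorem finite_crossingsA (hm : 1 ≤ m) (hf : IsALPP m k S f) : (crossingsA m S f).Finite := by
  obtain ⟨C, hC⟩ := hf.exists_displacement_bound hm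
  have : NeZero m := ⟨by omega⟩
  refine (Set.finite_univ.prod (Set.finite_Icc (0 : ℤ) (2 * C))).subset ?_
  rintro _ ⟨⟨i, j⟩, ⟨hi, hj, hij, hfij⟩, rfl⟩
  have h1 := abs_le.1 (hC i hi)
  have h2 := abs_le.1 (hC j hj)
  simp only at *
  refine ⟨Set.mem_univ _, ?_, ?_⟩ <;> simp only [crossKeyA] <;> linarith

theorem finite_weightSetA (hm : 1 ≤ m) (hf : IsALPP m k S f) (a : ℚ) :
    (weightSetA a S f).Finite := by
  obtain ⟨C, hC⟩ := hf.exists_displacement_bound hm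
  refine (Set.finite_Icc (⌊a⌋ - C) (⌈a⌉ + C)).subset ?_
  rintro i ⟨hi, h⟩
  have h1 := abs_le.1 (hC i hi)
  rcases h with ⟨ha, hb⟩ | ⟨ha, hb⟩
  · have := Int.floor_lt.2 hb
    have := Int.lt_ceil.2 ha
    constructor <;> linarith
  · have := Int.floor_lt.2 hb
    have := Int.lt_ceil.2 ha
    constructor <;> linarith

theorem comp (hf : IsALPP m k S f) (hg : IsALPP m k T g) (h : Set.MapsTo f S T) :
    IsALPP m k S (g ∘ f) where
  invariant := hf.invariant
  equivariant x hx := by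
    simp only [Function.comp_apply, hf.equivariant x hx, hg.equivariant _ (h hx)]
  orbits := hf.orbits
  inj x hx y hy hxy := hf.inj x hx y hy (hg.inj _ (h hx) _ (h hy) hxy)

theorem crossCountA_comp_le (hm : 1 ≤ m) (hf : IsALPP m k S f) (hg : IsALPP m k T g)
    (h : Set.MapsTo f S T) :
    crossCountA m S (g ∘ f) ≤ crossCountA m S f + crossCountA m T g := by
  set P : Set (ℤ × ℤ) :=
    {p | p.1 ∈ S ∧ p.2 ∈ S ∧ IsCrossing T g (f p.1) (f p.2)}
  have hsub : crossingsA m S (g ∘ f) ⊆ crossingsA m S f ∪ crossKeyA m '' P := by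
    rintro _ ⟨⟨i, j⟩, ⟨hi, hj, hij, hgf⟩, rfl⟩
    simp only [Function.comp_apply] at hi hj hij hgf
    rcases lt_trichotomy (f i) (f j) with hlt | heq | hgt
    · exact Or.inr ⟨(i, j), ⟨hi, hj, h hi, h hj, hlt, hgf⟩, rfl⟩
    · rw [heq] at hgf
      exact absurd hgf (lt_irrefl _)
    · exact Or.inl ⟨(i, j), ⟨hi, hj, hij, hgt⟩, rfl⟩
  choose! r hrP hr using
    fun (c : ZMod m × ℤ) (hc : c ∈ crossKeyA m '' P) => hc
  have hmaps : ∀ c ∈ crossKeyA m '' P,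
      crossKeyA m (f (r c).1, f (r c).2) ∈ crossingsA m T g := fun c hc =>
    ⟨_, (hrP c hc).2.2, rfl⟩
  have hinj : Set.InjOn (fun c => crossKeyA m (f (r c).1, f (r c).2)) (crossKeyA m '' P) := by
    intro c hc d hd hcd
    simp only [crossKeyA, Prod.mk.injEq] at hcd
    obtain ⟨hc1, hc2, -⟩ := hrP c hc
    obtain ⟨hd1, hd2, -⟩ := hrP d hd
    have h1 := hf.inj _ hc1 _ hd1 hcd.1
    obtain ⟨t, ht, hft⟩ := hf.exists_translate hc1 h1
    obtain ⟨hs, hfs⟩ := hf.translate hc2 t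
    have h2 : (r d).2 = (r c).2 + t * m := hf.injOn hd2 hs (by linarith [hcd.2])
    rw [← hr c hc, ← hr d hd]
    exact Prod.ext h1 (by simp only [crossKeyA]; linarith)
  have hfin := hg.finite_crossingsA hm
  have hfinP : (crossKeyA m '' P).Finite := Set.Finite.of_injOn hmaps hinj hfin
  calc (crossingsA m S (g ∘ f)).ncard
      ≤ (crossingsA m S f ∪ crossKeyA m '' P).ncard :=
        Set.ncard_le_ncard hsub ((hf.finite_crossingsA hm).union hfinP)
    _ ≤ (crossingsA m S f).ncard + (crossKeyA m '' P).ncard := Set.ncard_union_le _ _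
    _ ≤ (crossingsA m S f).ncard + (crossingsA m T g).ncard :=
        Nat.add_le_add_left (Set.ncard_le_ncard_of_injOn _ hmaps hinj hfin) _

theorem weightA_comp_le (hm : 1 ≤ m) (hf : IsALPP m k S f) (hg : IsALPP m k T g)
    (h : Set.MapsTo f S T) {a : ℚ} (ha : ∀ n : ℤ, (n : ℚ) ≠ a) :
    weightA a S (g ∘ f) ≤ weightA a S f + weightA a T g := by
  have hsub : weightSetA a S (g ∘ f) ⊆ weightSetA a S f ∪ (S ∩ f ⁻¹' weightSetA a T g) := by
    rintro i ⟨hi, ⟨h1, h2⟩ | ⟨h1, h2⟩⟩ <;> rcases lt_or_gt_of_ne (ha (f i)) with h3 | h3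
    · exact Or.inr ⟨hi, h hi, Or.inl ⟨h3, h2⟩⟩
    · exact Or.inl ⟨hi, Or.inl ⟨h1, h3⟩⟩
    · exact Or.inl ⟨hi, Or.inr ⟨h3, h2⟩⟩
    · exact Or.inr ⟨hi, h hi, Or.inr ⟨h1, h3⟩⟩
  have hmaps : ∀ i ∈ S ∩ f ⁻¹' weightSetA a T g, f i ∈ weightSetA a T g := fun i hi => hi.2
  have hinj : Set.InjOn f (S ∩ f ⁻¹' weightSetA a T g) := hf.injOn.mono Set.inter_subset_left
  have hfin := hg.finite_weightSetA hm a
  have hle : (weightSetA a S (g ∘ f)).ncard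
      ≤ (weightSetA a S f).ncard + (weightSetA a T g).ncard :=
    calc (weightSetA a S (g ∘ f)).ncard
        ≤ (weightSetA a S f ∪ (S ∩ f ⁻¹' weightSetA a T g)).ncard :=
          Set.ncard_le_ncard hsub
            ((hf.finite_weightSetA hm a).union (Set.Finite.of_injOn hmaps hinj hfin))
      _ ≤ (weightSetA a S f).ncard + (S ∩ f ⁻¹' weightSetA a T g).ncard :=
          Set.ncard_union_le _ _
      _ ≤ (weightSetA a S f).ncard + (weightSetA a T g).ncard :=
          Nat.add_le_add_left (Set.ncard_le_ncard_of_injOn f hmaps hinj hfin) _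
  have hle' : ((weightSetA a S (g ∘ f)).ncard : ℚ)
      ≤ (weightSetA a S f).ncard + (weightSetA a T g).ncard := by exact_mod_cast hle
  simp only [weightA]
  linarith

end IsALPP

theorem Int.cast_ne_add_half (n b : ℤ) : (n : ℚ) ≠ (b : ℚ) + 1 / 2 := by
  intro h
  have h2 : ((2 * n : ℤ) : ℚ) = ((2 * b + 1 : ℤ) : ℚ) := by
    push_cast
    linarith
  have h3 : 2 * n = 2 * b + 1 := by exact_mod_cast h2
  omega

/-- The composite of composable `mℤ`-lifted partial
permutations on `k` letters is an `mℤ`-lifted partial permutation on `k`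
letters, its set of crossings is finite, `cross(g∘f) ≤ cross(f) + cross(g)`,
and for every `a ∈ 1/2 + ℤ` one has `w_a(g∘f) ≤ w_a(f) + w_a(g)`. -/
theorem asteroids_comp (m k : ℕ) (hm : 1 ≤ m) (hk1 : 1 ≤ k) (hkm : k ≤ m)
    (S : Set ℤ) (f : ℤ → ℤ) (T : Set ℤ) (g : ℤ → ℤ)
    (hf : IsALPP m k S f) (hg : IsALPP m k T g) (hT : T = f '' S) :
    IsALPP m k S (g ∘ f) ∧
    (crossingsA m S (g ∘ f)).Finite ∧
    crossCountA m S (g ∘ f) ≤ crossCountA m S f + crossCountA m T g ∧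
    (∀ a : ℚ, (∃ b : ℤ, a = (b : ℚ) + 1/2) →
      weightA a S (g ∘ f) ≤ weightA a S f + weightA a T g) := by
  have hmaps : Set.MapsTo f S T := fun x hx => hT ▸ Set.mem_image_of_mem f hx
  have hgf := hf.comp hg hmaps
  refine ⟨hgf, hgf.finite_crossingsA hm, hf.crossCountA_comp_le hm hg hmaps, ?_⟩
  rintro a ⟨b, rfl⟩
  exact hf.weightA_comp_le hm hg hmaps fun n => Int.cast_ne_add_half n b
end
end
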